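/- arXiv:2502.13700 — 3 statements merged into one kernel-verified Lean document; each statement's English description precedes it below -/
import Mathlib

section
/- Let d, K be positive integers, τ ∈ ℝ, b ∈ ℝ^K, and let E : ℝ^d → ℝ^d and σ : ℝ^d → Matrix (Fin d) (Fin K) ℝ be measurable functions. Then the map Ψ̂ : ℝ^d × ℝ^d → ℝ^d × ℝ^d given by Ψ̂(x,v) = (x − τv + τ²E(x), v − τE(x) − σ(x − τv + τ²E(x))b) is measure preserving with respect to the Lebesgue measure (volume) on ℝ^d × ℝ^d. -/
open MeasureTheory

/-- A vertical shear `(x, v) ↦ (x, v + h x)` preserves a product measure whose second factor is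
right-translation invariant. -/
theorem measurePreserving_shear_snd {α G : Type*} [MeasurableSpace α] [MeasurableSpace G]
    [AddGroup G] [MeasurableAdd₂ G] (μ : Measure α) (ν : Measure G) [SFinite μ] [SFinite ν]
    [ν.IsAddRightInvariant] {h : α → G} (hh : Measurable h) :
    MeasurePreserving (fun p : α × G => (p.1, p.2 + h p.1)) (μ.prod ν) (μ.prod ν) :=
  (MeasurePreserving.id μ).skew_product (g := fun x v => v + h x)
    (measurable_snd.add (hh.comp measurable_fst))
    (Filter.Eventually.of_forall fun x => map_add_right_eq_self ν (h x))

/-- A horizontal shear `(x, v) ↦ (x + h v, v)` preserves a product measure whose first factor is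
right-translation invariant. -/
theorem measurePreserving_shear_fst {G β : Type*} [MeasurableSpace G] [MeasurableSpace β]
    [AddGroup G] [MeasurableAdd₂ G] (μ : Measure G) (ν : Measure β) [SFinite μ] [SFinite ν]
    [μ.IsAddRightInvariant] {h : β → G} (hh : Measurable h) :
    MeasurePreserving (fun p : G × β => (p.1 + h p.2, p.2)) (μ.prod ν) (μ.prod ν) :=
  Measure.measurePreserving_swap.comp
    ((measurePreserving_shear_snd ν μ hh).comp Measure.measurePreserving_swap)

/-- The inverse map of the Lie--Trotter splitting one-step integrator is volume preserving. -/
theorem ltsm_inverse_measurePreserving (d K : ℕ) (hd : 0 < d) (hK : 0 < K) (τ : ℝ)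
    (b : Fin K → ℝ)
    (E : (Fin d → ℝ) → (Fin d → ℝ)) (σ : (Fin d → ℝ) → Matrix (Fin d) (Fin K) ℝ)
    (hE : Measurable E) (hσ : ∀ (i : Fin d) (k : Fin K), Measurable (fun x => σ x i k))
    (Ψh : (Fin d → ℝ) × (Fin d → ℝ) → (Fin d → ℝ) × (Fin d → ℝ))
    (hΨh : ∀ x v : Fin d → ℝ,
      Ψh (x, v) = (x - τ • v + (τ^2) • E x,
        v - τ • E x - (σ (x - τ • v + (τ^2) • E x)).mulVec b)) :
    MeasurePreserving Ψh
      (volume : Measure ((Fin d → ℝ) × (Fin d → ℝ)))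
      (volume : Measure ((Fin d → ℝ) × (Fin d → ℝ))) := by
  have hσb : Measurable fun x => -(σ x).mulVec b := by
    refine (measurable_pi_lambda _ fun i => ?_).neg
    simp only [Matrix.mulVec, dotProduct]
    exact Finset.measurable_sum _ fun k _ => (hσ i k).mul_const (b k)
  have kick := measurePreserving_shear_snd (volume : Measure (Fin d → ℝ))
    (volume : Measure (Fin d → ℝ)) (hE.const_smul (-τ))
  have drift := measurePreserving_shear_fst (volume : Measure (Fin d → ℝ))
    (volume : Measure (Fin d → ℝ)) (measurable_id.const_smul (-τ))
  have noise := measurePreserving_shear_snd (volume : Measure (Fin d → ℝ))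
    (volume : Measure (Fin d → ℝ)) hσb
  suffices hΨ : Ψh = _ from hΨ ▸ noise.comp (drift.comp kick)
  funext ⟨x, v⟩
  have hx : x - τ • v + (τ ^ 2) • E x = x + (-τ) • (v + (-τ) • E x) := by module
  rw [hΨh, hx]
  simp [sub_eq_add_neg, add_comm]
end

section
/- Let d, K be positive integers, τ ∈ ℝ, b ∈ ℝ^K, and let E : ℝ^d → ℝ^d and σ : ℝ^d → Matrix (Fin d) (Fin K) ℝ be measurable functions. Then the map Ψ̂ : ℝ^d × ℝ^d → ℝ^d × ℝ^d given by Ψ̂(x,v) = (x − (τ/2)(v + w), w), where w = v − τE(x − (τ/2)v) − σ(x − (τ/2)v)b, is measure preserving with respect to the Lebesgue measure (volume) on ℝ^d × ℝ^d. -/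
open MeasureTheory

/-- The vertical shear `(x, y) ↦ (x, y - g x)` along a measurable function preserves `μ × ν`. -/
theorem measurePreserving_prod_sub_comp {α G : Type*} [MeasurableSpace α] [MeasurableSpace G]
    [AddGroup G] [MeasurableAdd G] [MeasurableSub₂ G] (μ : Measure α) (ν : Measure G)
    [SFinite μ] [SFinite ν] [ν.IsAddRightInvariant] {g : α → G} (hg : Measurable g) :
    MeasurePreserving (fun z : α × G => (z.1, z.2 - g z.1)) (μ.prod ν) (μ.prod ν) :=
  (MeasurePreserving.id μ).skew_product (g := fun x y => y - g x)
    (measurable_snd.sub (hg.comp measurable_fst))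
    (Filter.Eventually.of_forall fun x => by
      simpa only [sub_eq_add_neg] using map_add_right_eq_self ν (-g x))

/-- The horizontal shear `(x, y) ↦ (x - g y, y)` along a measurable function preserves `ν × μ`. -/
theorem measurePreserving_sub_comp_prod {α G : Type*} [MeasurableSpace α] [MeasurableSpace G]
    [AddGroup G] [MeasurableAdd G] [MeasurableSub₂ G] (μ : Measure α) (ν : Measure G)
    [SFinite μ] [SFinite ν] [ν.IsAddRightInvariant] {g : α → G} (hg : Measurable g) :
    MeasurePreserving (fun z : G × α => (z.1 - g z.2, z.2)) (ν.prod μ) (ν.prod μ) :=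
  Measure.measurePreserving_swap.comp
    ((measurePreserving_prod_sub_comp μ ν hg).comp Measure.measurePreserving_swap)

/-- The inverse map of the Strang splitting one-step integrator is volume preserving. -/
theorem ssm_inverse_measurePreserving (d K : ℕ) (hd : 0 < d) (hK : 0 < K) (τ : ℝ)
    (b : Fin K → ℝ)
    (E : (Fin d → ℝ) → (Fin d → ℝ)) (σ : (Fin d → ℝ) → Matrix (Fin d) (Fin K) ℝ)
    (hE : Measurable E) (hσ : ∀ (i : Fin d) (k : Fin K), Measurable (fun x => σ x i k))
    (Ψh : (Fin d → ℝ) × (Fin d → ℝ) → (Fin d → ℝ) × (Fin d → ℝ))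
    (hΨh : ∀ x v : Fin d → ℝ,
      Ψh (x, v) = (x - (τ/2) •
          (v + (v - τ • E (x - (τ/2) • v) - (σ (x - (τ/2) • v)).mulVec b)),
        v - τ • E (x - (τ/2) • v) - (σ (x - (τ/2) • v)).mulVec b)) :
    MeasurePreserving Ψh
      (volume : Measure ((Fin d → ℝ) × (Fin d → ℝ)))
      (volume : Measure ((Fin d → ℝ) × (Fin d → ℝ))) := by
  have hkick : Measurable fun x => τ • E x + (σ x).mulVec b := by
    refine (hE.const_smul τ).add (measurable_pi_lambda _ fun i => ?_)
    simp only [Matrix.mulVec, dotProduct]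
    exact Finset.measurable_sum _ fun k _ => (hσ i k).mul_const (b k)
  have hdrift : MeasurePreserving
      (fun z : (Fin d → ℝ) × (Fin d → ℝ) => (z.1 - (τ / 2) • z.2, z.2)) volume volume :=
    measurePreserving_sub_comp_prod volume volume (measurable_id.const_smul (τ / 2))
  convert hdrift.comp ((measurePreserving_prod_sub_comp volume volume hkick).comp hdrift) using 1
  ext1 ⟨x, v⟩
  rw [hΨh]
  simp only [Function.comp_apply, smul_add, sub_sub]
end

section
/- Let d, K be positive integers, t ≥ 0, E₀ ∈ ℝ^d, and σ ∈ Matrix (Fin d) (Fin K) ℝ. Let f₀ : ℝ^d × ℝ^d → ℝ be measurable and nonnegative with ∫∫ f₀(x,v) dx dv = 1 and ∫∫ ‖v‖² f₀(x,v) dx dv < ∞. Let (Ω, 𝔽, ℙ) be a probability space and W : Ω → ℝ^K a square-integrable random vector with 𝔼[W_k] = 0 for all k and 𝔼[W_j W_k] = t·δ_{jk} for all j,k. Then 𝔼[ ∫∫ (1/2)‖v + t E₀ + σ W‖² f₀(x,v) dx dv ] = ∫∫ (1/2)‖v‖² f₀(x,v) dx dv + ( E₀ · ∫∫ v f₀(x,v)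 dx dv + (1/2) Tr(σσᵀ) ) t + (1/2) ‖E₀‖² t². -/
open MeasureTheory

section VelocityMoments

variable {d : ℕ} {f : (Fin d → ℝ) × (Fin d → ℝ) → ℝ}

/-- The second velocity moments of a density with finite kinetic energy exist. -/
theorem integrable_mul_velocity_sq (hf : Measurable f)
    (hmom : Integrable (fun p : (Fin d → ℝ) × (Fin d → ℝ) => ‖p.2‖ ^ 2 * f p)) (i : Fin d) :
    Integrable (fun p : (Fin d → ℝ) × (Fin d → ℝ) => f p * p.2 i ^ 2) := by
  refine hmom.mono (by fun_prop) (.of_forall fun p => ?_)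
  have h : ‖p.2 i‖ ^ 2 ≤ ‖p.2‖ ^ 2 := by gcongr; exact norm_le_pi_norm _ _
  rw [norm_mul, norm_mul, norm_pow, norm_pow, norm_norm, mul_comm]
  gcongr

/-- The momentum of an integrable density with finite kinetic energy exists. -/
theorem integrable_smul_velocity (hf : Measurable f) (hint : Integrable f)
    (hmom : Integrable (fun p : (Fin d → ℝ) × (Fin d → ℝ) => ‖p.2‖ ^ 2 * f p)) :
    Integrable (fun p : (Fin d → ℝ) × (Fin d → ℝ) => f p • p.2) := by
  refine (hint.norm.add hmom.norm).mono (by fun_prop) (.of_forall fun p => ?_)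
  have h : ‖p.2‖ ≤ 1 + ‖p.2‖ ^ 2 := by nlinarith [sq_nonneg (‖p.2‖ - 1)]
  have hle := mul_le_mul_of_nonneg_left h (norm_nonneg (f p))
  rw [norm_smul]
  refine hle.trans (le_of_eq_of_le ?_ (Real.le_norm_self _))
  simp only [Pi.add_apply, norm_mul, norm_pow, norm_norm]
  ring

/-- The kinetic energy of a unit-mass density under a velocity shift `c`. -/
theorem integral_kinetic_energy_shift (hf : Measurable f) (hint : Integrable f)
    (hmass : ∫ p, f p = 1)
    (hmom : Integrable (fun p : (Fin d → ℝ) × (Fin d → ℝ) => ‖p.2‖ ^ 2 * f p))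
    (c : Fin d → ℝ) :
    ∫ p : (Fin d → ℝ) × (Fin d → ℝ), f p * ((1 / 2) * ∑ i, (p.2 i + c i) ^ 2)
      = (∫ p : (Fin d → ℝ) × (Fin d → ℝ), f p * ((1 / 2) * ∑ i, (p.2 i) ^ 2))
        + ∑ i, c i * (∫ p : (Fin d → ℝ) × (Fin d → ℝ), f p • p.2) i
        + (1 / 2) * ∑ i, c i ^ 2 := by
  have hvec := integrable_smul_velocity hf hint hmom
  have hcoord (i : Fin d) : Integrable (fun p : (Fin d → ℝ) × (Fin d → ℝ) => f p * p.2 i) := by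
    simpa using hvec.eval i
  have hmomentum (i : Fin d) : (∫ p : (Fin d → ℝ) × (Fin d → ℝ), f p • p.2) i
      = ∫ p : (Fin d → ℝ) × (Fin d → ℝ), f p * p.2 i := by
    rw [eval_integral fun j => hvec.eval j]
    simp
  have henergy : Integrable
      (fun p : (Fin d → ℝ) × (Fin d → ℝ) => f p * ((1 / 2) * ∑ i, (p.2 i) ^ 2)) := by
    refine ((integrable_finsetSum Finset.univ fun i _ =>
      integrable_mul_velocity_sq hf hmom i).const_mul (1 / 2)).congr (.of_forall fun p => ?_)
    simp only [← Finset.mul_sum]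
    ring
  have hlin : Integrable
      (fun p : (Fin d → ℝ) × (Fin d → ℝ) => ∑ i, c i * (f p * p.2 i)) :=
    integrable_finsetSum _ fun i _ => (hcoord i).const_mul _
  have hexpand (p : (Fin d → ℝ) × (Fin d → ℝ)) :
      f p * ((1 / 2) * ∑ i, (p.2 i + c i) ^ 2) = f p * ((1 / 2) * ∑ i, (p.2 i) ^ 2)
        + ∑ i, c i * (f p * p.2 i) + ((1 / 2) * ∑ i, c i ^ 2) * f p := by
    simp only [Finset.mul_sum, Finset.sum_mul, ← Finset.sum_add_distrib]
    exact Finset.sum_congr rfl fun i _ => by ring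
  simp_rw [hexpand, hmomentum]
  rw [integral_add (henergy.fun_add hlin) (hint.const_mul _), integral_add henergy hlin,
    integral_const_mul, hmass, integral_finsetSum _ fun i _ => (hcoord i).const_mul _]
  simp only [integral_const_mul, mul_one]

end VelocityMoments

section LinearImage

variable {Ω ι κ : Type*} [MeasurableSpace Ω] {μ : Measure Ω} [Fintype κ] {W : Ω → κ → ℝ}

theorem integrable_mulVec_apply (σ : Matrix ι κ ℝ) (hW : ∀ k, Integrable (fun ω => W ω k) μ)
    (i : ι) : Integrable (fun ω => σ.mulVec (W ω) i) μ :=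
  integrable_finsetSum _ fun k _ => (hW k).const_mul (σ i k)

theorem integral_mulVec_apply_eq_zero (σ : Matrix ι κ ℝ)
    (hW : ∀ k, Integrable (fun ω => W ω k) μ) (hmean : ∀ k, ∫ ω, W ω k ∂μ = 0) (i : ι) :
    ∫ ω, σ.mulVec (W ω) i ∂μ = 0 := by
  simp only [Matrix.mulVec, dotProduct]
  rw [integral_finsetSum _ fun k _ => (hW k).const_mul (σ i k)]
  simp [integral_const_mul, hmean]

theorem mulVec_apply_sq (σ : Matrix ι κ ℝ) (w : κ → ℝ) (i : ι) :
    σ.mulVec w i ^ 2 = ∑ j, ∑ k, σ i j * σ i k * (w j * w k) := by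
  simp only [Matrix.mulVec, dotProduct, sq, Finset.sum_mul_sum]
  exact Finset.sum_congr rfl fun j _ => Finset.sum_congr rfl fun k _ => by ring

theorem integrable_mulVec_apply_sq (σ : Matrix ι κ ℝ)
    (hW : ∀ j k, Integrable (fun ω => W ω j * W ω k) μ) (i : ι) :
    Integrable (fun ω => σ.mulVec (W ω) i ^ 2) μ := by
  simp only [mulVec_apply_sq]
  exact integrable_finsetSum _ fun j _ => integrable_finsetSum _ fun k _ =>
    (hW j k).const_mul _

/-- A random vector with covariance `t • 1` has a linear image with covariance diagonal
`t • diag (σ * σᵀ)`. -/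
theorem integral_mulVec_apply_sq [DecidableEq κ] (σ : Matrix ι κ ℝ) {t : ℝ}
    (hW : ∀ j k, Integrable (fun ω => W ω j * W ω k) μ)
    (hcov : ∀ j k, ∫ ω, W ω j * W ω k ∂μ = if j = k then t else 0) (i : ι) :
    ∫ ω, σ.mulVec (W ω) i ^ 2 ∂μ = (σ * σ.transpose) i i * t := by
  simp only [mulVec_apply_sq]
  rw [integral_finsetSum _ fun j _ => integrable_finsetSum _ fun k _ => (hW j k).const_mul _]
  simp only [integral_finsetSum _ fun k _ => (hW _ k).const_mul _, integral_const_mul, hcov]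
  simp [Matrix.mul_apply, Finset.sum_mul]

end LinearImage

/-- Evolution of the averaged kinetic energy: for a unit-mass nonnegative density `f₀` with
finite second velocity moment and a square-integrable random vector `W` with zero mean and
covariance `t·I`, the expectation of `∫∫ ½‖v + tE₀ + σW‖² f₀ dx dv` equals
`∫∫ ½‖v‖² f₀ + (E₀·𝒫[f₀] + ½Tr(σσᵀ)) t + ½‖E₀‖² t²` (Euclidean norms, written
coordinatewise). -/
theorem averaged_kinetic_energy_evolution (d K : ℕ) (hd : 0 < d) (hK : 0 < K)
    (t : ℝ) (ht : 0 ≤ t) (E₀ : Fin d → ℝ) (σ : Matrix (Fin d) (Fin K) ℝ)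
    (f₀ : (Fin d → ℝ) × (Fin d → ℝ) → ℝ)
    (hf₀_meas : Measurable f₀)
    (hf₀_nonneg : ∀ p, 0 ≤ f₀ p)
    (hf₀_int : Integrable f₀)
    (hf₀_mass : ∫ p, f₀ p = 1)
    (hf₀_mom2 : Integrable (fun p : (Fin d → ℝ) × (Fin d → ℝ) => ‖p.2‖^2 * f₀ p))
    (Ω : Type*) [MeasureSpace Ω] [IsProbabilityMeasure (volume : Measure Ω)]
    (W : Ω → Fin K → ℝ)
    (hW1 : ∀ k, Integrable (fun ω => W ω k))
    (hW2 : ∀ j k : Fin K, Integrable (fun ω => W ω j * W ω k))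
    (hWmean : ∀ k, ∫ ω, W ω k = 0)
    (hWcov : ∀ j k : Fin K, ∫ ω, W ω j * W ω k = if j = k then t else 0) :
    ∫ ω, (∫ p : (Fin d → ℝ) × (Fin d → ℝ),
        f₀ p * ((1/2) * ∑ i, (p.2 i + t * E₀ i + σ.mulVec (W ω) i)^2))
      = (∫ p : (Fin d → ℝ) × (Fin d → ℝ), f₀ p * ((1/2) * ∑ i, (p.2 i)^2))
        + ((∑ i, E₀ i * (∫ p : (Fin d → ℝ) × (Fin d → ℝ), f₀ p • p.2) i)
            + (1/2) * Matrix.trace (σ * σ.transpose)) * t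
        + (1/2) * (∑ i, (E₀ i)^2) * t^2 := by
  simp only [add_assoc _ (t * E₀ _)]
  simp_rw [integral_kinetic_energy_shift hf₀_meas hf₀_int hf₀_mass hf₀_mom2
    (fun i => t * E₀ i + σ.mulVec (W _) i)]
  set A := ∫ p : (Fin d → ℝ) × (Fin d → ℝ), f₀ p * ((1/2) * ∑ i, (p.2 i)^2)
  set P := ∫ p : (Fin d → ℝ) × (Fin d → ℝ), f₀ p • p.2
  have hY (i : Fin d) : Integrable (fun ω => (P i + t * E₀ i) * σ.mulVec (W ω) i) :=
    (integrable_mulVec_apply σ hW1 i).const_mul _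
  have hY2 (i : Fin d) : Integrable (fun ω => (1/2) * σ.mulVec (W ω) i ^ 2) :=
    (integrable_mulVec_apply_sq σ hW2 i).const_mul _
  have hsum (ω : Ω) : A + ∑ i, (t * E₀ i + σ.mulVec (W ω) i) * P i
        + (1/2) * ∑ i, (t * E₀ i + σ.mulVec (W ω) i) ^ 2
      = (A + (∑ i, E₀ i * P i) * t + (1/2) * (∑ i, (E₀ i)^2) * t^2)
        + ∑ i, ((P i + t * E₀ i) * σ.mulVec (W ω) i + (1/2) * σ.mulVec (W ω) i ^ 2) := by
    simp only [Finset.mul_sum, Finset.sum_mul, add_assoc, ← Finset.sum_add_distrib]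
    congr 1
    exact Finset.sum_congr rfl fun i _ => by ring
  simp_rw [hsum]
  rw [integral_add (integrable_const _) (integrable_finsetSum _ fun i _ => (hY i).fun_add (hY2 i)),
    integral_finsetSum _ fun i _ => (hY i).fun_add (hY2 i)]
  simp only [integral_add (hY _) (hY2 _), integral_const_mul,
    integral_mulVec_apply_eq_zero σ hW1 hWmean, integral_mulVec_apply_sq σ hW2 hWcov,
    integral_const, probReal_univ, one_smul, mul_zero, zero_add, Matrix.trace, Matrix.diag_apply,
    ← Finset.mul_sum, ← Finset.sum_mul]
  ring
end
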